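/- arXiv:1903.04287 — 2 statements merged into one kernel-verified Lean document; each statement's English description precedes it below -/
import Mathlib

section
/- Let M be a cyclic submodule of ²T(q) that is not free. Then M is contained in no free cyclic submodule of ²T(q) generated by a non-unimodular pair if and only if M = T(q)((0,0; p21,p22), (0,0; r21,r22)) for some p21, p22, r21, r22 ∈ F with (p22, r22) ≠ (0, 0). -/
open Matrix

/-- `Mat n F` is the type of `n × n` matrices over `F`. -/
abbrev Mat (n : ℕ) (F : Type) : Type := Matrix (Fin n) (Fin n) F

/-- A matrix is lower triangular (i.e. belongs to the ring `T_n(q)`)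
if all entries above the diagonal vanish. -/
def LowerTri {n : ℕ} {F : Type} [Zero F] (X : Mat n F) : Prop :=
  ∀ i j : Fin n, i < j → X i j = 0

/-- The cyclic left submodule `T_n(q)(X,Y)` of `²T_n(q)` generated by the pair `(X,Y)`. -/
def cyc {n : ℕ} {F : Type} [Field F] (X Y : Mat n F) : Set (Mat n F × Mat n F) :=
  {p | ∃ A : Mat n F, LowerTri A ∧ p = (A * X, A * Y)}

/-- The pair `(X,Y)` generates a *free* cyclic submodule:
`A • (X,Y) = (0,0)` with `A ∈ T_n(q)` forces `A = 0`. -/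
def IsFreePair {n : ℕ} {F : Type} [Field F] (X Y : Mat n F) : Prop :=
  ∀ A : Mat n F, LowerTri A → A * X = 0 → A * Y = 0 → A = 0

/-- A pair `(X,Y)` is unimodular if for every index `i` one of the `i`-th
diagonal entries of `X`, `Y` is nonzero. -/
def Unimodular {n : ℕ} {F : Type} [Field F] (X Y : Mat n F) : Prop :=
  ∀ i : Fin n, X i i ≠ 0 ∨ Y i i ≠ 0

/-- `M` is a free cyclic submodule of `²T_n(q)`. -/
def IsFreeCyc {n : ℕ} {F : Type} [Field F] (M : Set (Mat n F × Mat n F)) : Prop :=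
  ∃ X Y : Mat n F, LowerTri X ∧ LowerTri Y ∧ IsFreePair X Y ∧ M = cyc X Y

/-- `M` is a free cyclic submodule of `²T_n(q)` generated by a non-unimodular pair. -/
def IsNonUnimodFreeCyc {n : ℕ} {F : Type} [Field F] (M : Set (Mat n F × Mat n F)) : Prop :=
  ∃ X Y : Mat n F, LowerTri X ∧ LowerTri Y ∧ ¬ Unimodular X Y ∧ IsFreePair X Y ∧ M = cyc X Y

theorem lowerTri_of_two {F : Type} [Zero F] (a b c : F) : LowerTri !![a, 0; b, c] := by
  intro i j h
  fin_cases i <;> fin_cases j <;> simp_all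

theorem LowerTri.eq_of {F : Type} [Zero F] {X : Mat 2 F} (h : LowerTri X) :
    X = !![X 0 0, 0; X 1 0, X 1 1] := by
  have h01 : X 0 1 = 0 := h 0 1 (by decide)
  ext i j
  fin_cases i <;> fin_cases j <;> simp [h01]

theorem lowerTri_mul_two {F : Type} [Field F] (a b c x y z : F) :
    !![a, 0; b, c] * !![x, 0; y, z] = !![a * x, 0; b * x + c * y, c * z] := by
  ext i j
  fin_cases i <;> fin_cases j <;> simp [Matrix.mul_apply, Fin.sum_univ_two]

theorem exists_lowerTri_mul_two_eq {F : Type} [Field F] {X Y : Mat 2 F} (hX : LowerTri X)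
    (hY : LowerTri Y) {P : Mat 2 F × Mat 2 F} (hP : P ∈ cyc X Y) :
    ∃ a b c : F,
      P = (!![a * X 0 0, 0; b * X 0 0 + c * X 1 0, c * X 1 1],
        !![a * Y 0 0, 0; b * Y 0 0 + c * Y 1 0, c * Y 1 1]) := by
  obtain ⟨A, hA, rfl⟩ := hP
  refine ⟨A 0 0, A 1 0, A 1 1, ?_⟩
  rw [← lowerTri_mul_two, ← lowerTri_mul_two, ← hA.eq_of, ← hX.eq_of, ← hY.eq_of]

theorem eq_zero_of_lowerTri_mul_two {F : Type} [Field F] {A : Mat 2 F} (hA : LowerTri A)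
    {x y z : F} (h : A * !![x, 0; y, z] = 0) :
    A 0 0 * x = 0 ∧ A 1 0 * x + A 1 1 * y = 0 ∧ A 1 1 * z = 0 := by
  rw [hA.eq_of, lowerTri_mul_two] at h
  exact ⟨congrFun₂ h 0 0, congrFun₂ h 1 0, congrFun₂ h 1 1⟩

theorem LowerTri.eq_zero {F : Type} [Field F] {A : Mat 2 F} (hA : LowerTri A)
    (h00 : A 0 0 = 0) (h10 : A 1 0 = 0) (h11 : A 1 1 = 0) : A = 0 := by
  rw [hA.eq_of, h00, h10, h11]
  ext i j
  fin_cases i <;> fin_cases j <;> rfl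

theorem Unimodular.isFreePair {F : Type} [Field F] {X Y : Mat 2 F} (hX : LowerTri X)
    (hY : LowerTri Y) (hXY : Unimodular X Y) : IsFreePair X Y := by
  intro A hA hAX hAY
  rw [hX.eq_of] at hAX
  rw [hY.eq_of] at hAY
  obtain ⟨x1, x2, x3⟩ := eq_zero_of_lowerTri_mul_two hA hAX
  obtain ⟨y1, y2, y3⟩ := eq_zero_of_lowerTri_mul_two hA hAY
  have h11 : A 1 1 = 0 := by
    rcases hXY 1 with h | h <;> simp_all
  have h00 : A 0 0 = 0 := by
    rcases hXY 0 with h | h <;> simp_all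
  have h10 : A 1 0 = 0 := by
    rcases hXY 0 with h | h <;> simp_all
  exact hA.eq_zero h00 h10 h11

theorem isNonUnimodFreeCyc_of_det_ne_zero {F : Type} [Field F] {p r s t : F}
    (h : p * t - r * s ≠ 0) : IsNonUnimodFreeCyc (cyc !![p, 0; s, 0] !![r, 0; t, 0]) := by
  refine ⟨_, _, lowerTri_of_two p s 0, lowerTri_of_two r t 0, fun hu => ?_, ?_, rfl⟩
  · simpa using hu 1
  intro A hA hAX hAY
  obtain ⟨x1, x2, -⟩ := eq_zero_of_lowerTri_mul_two hA hAX
  obtain ⟨y1, y2, -⟩ := eq_zero_of_lowerTri_mul_two hA hAY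
  refine hA.eq_zero ?_ ?_ ?_ <;> refine (mul_eq_zero.mp ?_).resolve_right h
  · linear_combination t * x1 - s * y1
  · linear_combination t * x2 - s * y2
  · linear_combination p * y2 - r * x2

theorem exists_multiple_det_ne_zero {F : Type} [Field F] (x y : F) :
    ∃ p r s t k : F, p * t - r * s ≠ 0 ∧ x = k * p ∧ y = k * r := by
  by_cases hx : x = 0
  · exact ⟨0, 1, 1, 0, y, by simp, by simp [hx], by simp⟩
  · exact ⟨x, y, 0, 1, 1, by simpa using hx, by simp, by simp⟩

/-- A cyclic submodule generated by a pair with vanishing `(2,2)` entries lies in a free cyclic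
submodule generated by a non-unimodular pair. -/
theorem exists_isNonUnimodFreeCyc_superset {F : Type} [Field F] {X Y : Mat 2 F}
    (hX : LowerTri X) (hY : LowerTri Y) (hX1 : X 1 1 = 0) (hY1 : Y 1 1 = 0) :
    ∃ N, IsNonUnimodFreeCyc N ∧ cyc X Y ⊆ N := by
  obtain ⟨p, r, s, t, k, hd, hx, hy⟩ := exists_multiple_det_ne_zero (X 0 0) (Y 0 0)
  refine ⟨_, isNonUnimodFreeCyc_of_det_ne_zero hd, fun P hP => ?_⟩
  obtain ⟨a, b, c, rfl⟩ := exists_lowerTri_mul_two_eq hX hY hP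
  set e := b * X 0 0 + c * X 1 0
  set f := b * Y 0 0 + c * Y 1 0
  refine ⟨!![a * k, 0; (e * t - f * s) / (p * t - r * s), (p * f - r * e) / (p * t - r * s)],
    lowerTri_of_two _ _ _, ?_⟩
  have he : (e * t - f * s) / (p * t - r * s) * p + (p * f - r * e) / (p * t - r * s) * s = e := by
    rw [div_mul_eq_mul_div, div_mul_eq_mul_div, ← add_div, div_eq_iff hd]
    ring
  have hf : (e * t - f * s) / (p * t - r * s) * r + (p * f - r * e) / (p * t - r * s) * t = f := by
    rw [div_mul_eq_mul_div, div_mul_eq_mul_div, ← add_div, div_eq_iff hd]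
    ring
  rw [lowerTri_mul_two, lowerTri_mul_two, he, hf, hX1, hY1, hx, hy]
  simp [mul_assoc]

theorem stmt_6 (q : ℕ) (hq : 2 ≤ q)
    (F : Type) [Field F] [Fintype F] (hF : Fintype.card F = q)
    (M : Set (Mat 2 F × Mat 2 F))
    (hcyc : ∃ X Y : Mat 2 F, LowerTri X ∧ LowerTri Y ∧ M = cyc X Y)
    (hnotfree : ¬ IsFreeCyc M) :
    (∀ N : Set (Mat 2 F × Mat 2 F), IsNonUnimodFreeCyc N → ¬ M ⊆ N) ↔
      ∃ p21 p22 r21 r22 : F, (p22, r22) ≠ (0, 0) ∧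
        M = cyc !![0, 0; p21, p22] !![0, 0; r21, r22] := by
  constructor
  · intro hN
    obtain ⟨X, Y, hX, hY, rfl⟩ := hcyc
    have h1 : X 1 1 ≠ 0 ∨ Y 1 1 ≠ 0 := by
      by_contra! h
      obtain ⟨N, hNfree, hsub⟩ := exists_isNonUnimodFreeCyc_superset hX hY h.1 h.2
      exact hN N hNfree hsub
    have h0 : X 0 0 = 0 ∧ Y 0 0 = 0 := by
      by_contra h
      refine hnotfree ⟨X, Y, hX, hY,
        Unimodular.isFreePair hX hY (Fin.forall_fin_two.mpr ⟨?_, h1⟩),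
        rfl⟩
      tauto
    refine ⟨X 1 0, X 1 1, Y 1 0, Y 1 1, ?_, ?_⟩
    · rw [Ne, Prod.mk.injEq]
      tauto
    · conv_lhs => rw [hX.eq_of, hY.eq_of, h0.1, h0.2]
  · rintro ⟨p21, p22, r21, r22, hne, rfl⟩ N ⟨X, Y, hX, hY, hnu, hfree, rfl⟩ hsub
    refine hnu (Fin.forall_fin_two.mpr ⟨?_, ?_⟩)
    · by_contra! h
      have hz := hfree !![1, 0; 0, 0] (lowerTri_of_two _ _ _)
        (by rw [hX.eq_of, lowerTri_mul_two, h.1]; ext i j; fin_cases i <;> fin_cases j <;> simp)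
        (by rw [hY.eq_of, lowerTri_mul_two, h.2]; ext i j; fin_cases i <;> fin_cases j <;> simp)
      simpa using congrFun₂ hz 0 0
    · by_contra! h
      have hmem := hsub ⟨1, fun i j hij => Matrix.one_apply_ne hij.ne, rfl⟩
      obtain ⟨a, b, c, hP⟩ := exists_lowerTri_mul_two_eq hX hY hmem
      rw [one_mul, one_mul, Prod.mk.injEq, h.1, h.2] at hP
      have hp := congrFun₂ hP.1 1 1
      have hr := congrFun₂ hP.2 1 1
      simp at hp hr
      exact hne (by rw [hp, hr])
end

section
/- There are exactly q·(q+1)² cyclic submodules of ²T(q) generated by unimodular pairs; that is, the projective line over T(q) has exactly q(q+1)² points. -/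
open Matrix

section ProjectiveLine

variable {F : Type} [Field F]

lemma lowerTri_two_iff (A : Mat 2 F) : LowerTri A ↔ A 0 1 = 0 := by
  simp [LowerTri, Fin.forall_fin_two]

lemma LowerTri.mul {A B : Mat 2 F} (hA : LowerTri A) (hB : LowerTri B) : LowerTri (A * B) := by
  rw [lowerTri_two_iff] at *
  simp [Matrix.mul_apply, Fin.sum_univ_two, hA, hB]

lemma mem_cyc_self (X Y : Mat 2 F) : (X, Y) ∈ cyc X Y :=
  ⟨1, (lowerTri_two_iff _).2 (by simp), by simp⟩

lemma cyc_mul_subset {A : Mat 2 F} (hA : LowerTri A) (X Y : Mat 2 F) :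
    cyc (A * X) (A * Y) ⊆ cyc X Y := by
  rintro p ⟨B, hB, rfl⟩
  exact ⟨B * A, hB.mul hA, by simp [Matrix.mul_assoc]⟩

/-- A lower triangular matrix with nonzero diagonal acts without changing the cyclic submodule. -/
lemma cyc_mul_eq {a b c : F} (ha : a ≠ 0) (hb : b ≠ 0) (X Y : Mat 2 F) :
    cyc (!![a, 0; c, b] * X) (!![a, 0; c, b] * Y) = cyc X Y := by
  refine (cyc_mul_subset ((lowerTri_two_iff _).2 (by simp)) X Y).antisymm ?_
  have hinv : !![a⁻¹, 0; -(c * a⁻¹ * b⁻¹), b⁻¹] * !![a, 0; c, b] = 1 := by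
    ext i j
    fin_cases i <;> fin_cases j <;> simp [Matrix.mul_apply, Fin.sum_univ_two, ha, hb]
    field_simp
    ring
  have h := cyc_mul_subset (A := !![a⁻¹, 0; -(c * a⁻¹ * b⁻¹), b⁻¹])
    ((lowerTri_two_iff _).2 (by simp)) (!![a, 0; c, b] * X) (!![a, 0; c, b] * Y)
  rwa [← Matrix.mul_assoc, ← Matrix.mul_assoc, hinv, Matrix.one_mul, Matrix.one_mul] at h

/-- The normalized representative of a point of the projective line over `F`,
where `none` is the point at infinity. -/
def pointRep : Option F → F × F
  | some m => (1, m)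
  | none => (0, 1)

/-- A vector spanning a complement of the line through `pointRep o`. -/
def complRep : Option F → F × F
  | some _ => (0, 1)
  | none => (1, 0)

lemma pointRep_ne_zero (o : Option F) : (pointRep o).1 ≠ 0 ∨ (pointRep o).2 ≠ 0 := by
  cases o <;> simp [pointRep]

lemma exists_eq_smul_pointRep {a b : F} (h : a ≠ 0 ∨ b ≠ 0) :
    ∃ (o : Option F) (k : F), k ≠ 0 ∧ a = k * (pointRep o).1 ∧ b = k * (pointRep o).2 := by
  by_cases ha : a = 0
  · exact ⟨none, b, by simpa [ha] using h, by simp [pointRep, ha], by simp [pointRep]⟩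
  · exact ⟨some (b / a), a, ha, by simp [pointRep], by simp [pointRep]; field_simp⟩

lemma exists_eq_add_complRep (o : Option F) (c d : F) :
    ∃ t w : F, c = t * (pointRep o).1 + w * (complRep o).1 ∧
      d = t * (pointRep o).2 + w * (complRep o).2 := by
  cases o with
  | none => exact ⟨d, c, by simp [pointRep, complRep], by simp [pointRep, complRep]⟩
  | some m => exact ⟨c, d - c * m, by simp [pointRep, complRep], by simp [pointRep, complRep]⟩

lemma eq_of_pointRep_eq_smul {o o' : Option F} {k : F}
    (h₁ : (pointRep o).1 = k * (pointRep o').1) (h₂ : (pointRep o).2 = k * (pointRep o').2) :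
    o = o' ∧ k = 1 := by
  cases o <;> cases o' <;> simp [pointRep] at h₁ h₂ ⊢
  · exact h₂.symm
  · simp [← h₁] at h₂
  · simpa [← h₁] using h₂

lemma eq_of_smul_complRep_eq {o : Option F} {t z w : F}
    (h₁ : z * (complRep o).1 = t * (pointRep o).1 + w * (complRep o).1)
    (h₂ : z * (complRep o).2 = t * (pointRep o).2 + w * (complRep o).2) : z = w := by
  cases o <;> simp [pointRep, complRep] at h₁ h₂
  · simpa [← h₂] using h₁
  · simpa [← h₁] using h₂

/-- The first component of the normal form of a unimodular pair. -/
def normalFst (p : Option F × Option F × F) : Mat 2 F :=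
  !![(pointRep p.1).1, 0; p.2.2 * (complRep p.1).1, (pointRep p.2.1).1]

/-- The second component of the normal form of a unimodular pair. -/
def normalSnd (p : Option F × Option F × F) : Mat 2 F :=
  !![(pointRep p.1).2, 0; p.2.2 * (complRep p.1).2, (pointRep p.2.1).2]

lemma cyc_normal_injective :
    Function.Injective fun p : Option F × Option F × F => cyc (normalFst p) (normalSnd p) := by
  rintro ⟨o, r, z⟩ ⟨o', r', z'⟩ h
  have hmem := mem_cyc_self (normalFst (o, r, z)) (normalSnd (o, r, z))
  simp only at h
  rw [h] at hmem
  obtain ⟨A, hA, hXY⟩ := hmem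
  rw [lowerTri_two_iff] at hA
  obtain ⟨hX, hY⟩ := Prod.mk.inj hXY
  have entry (i j) := congrFun₂ hX i j
  have entry' (i j) := congrFun₂ hY i j
  have x₀ := entry 0 0
  have x₁ := entry 1 0
  have x₂ := entry 1 1
  have y₀ := entry' 0 0
  have y₁ := entry' 1 0
  have y₂ := entry' 1 1
  simp only [normalFst, normalSnd, Matrix.mul_apply, Fin.sum_univ_two, hA, Matrix.of_apply,
    Matrix.cons_val_zero, Matrix.cons_val_one, zero_mul, mul_zero, add_zero, zero_add]
    at x₀ x₁ x₂ y₀ y₁ y₂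
  obtain ⟨rfl, -⟩ := eq_of_pointRep_eq_smul x₀ y₀
  obtain ⟨rfl, h₁⟩ := eq_of_pointRep_eq_smul x₂ y₂
  rw [h₁, one_mul] at x₁ y₁
  rw [eq_of_smul_complRep_eq x₁ y₁]

lemma exists_cyc_eq_normal {X Y : Mat 2 F} (hX : LowerTri X) (hY : LowerTri Y)
    (h : Unimodular X Y) : ∃ p, cyc (normalFst p) (normalSnd p) = cyc X Y := by
  rw [lowerTri_two_iff] at hX hY
  obtain ⟨o, a, ha, hXa, hYa⟩ := exists_eq_smul_pointRep (h 0)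
  obtain ⟨r, b, hb, hXb, hYb⟩ := exists_eq_smul_pointRep (h 1)
  obtain ⟨t, w, hXt, hYt⟩ := exists_eq_add_complRep o (X 1 0) (Y 1 0)
  refine ⟨(o, r, w / b), ?_⟩
  rw [← cyc_mul_eq (c := t) ha hb]
  congr 1
  · ext i j
    fin_cases i <;> fin_cases j <;>
      simp [normalFst, hX, hXa, hXb, hXt]
    field_simp
  · ext i j
    fin_cases i <;> fin_cases j <;>
      simp [normalSnd, hY, hYa, hYb, hYt]
    field_simp

lemma setOf_unimodular_cyc_eq_range :
    {M : Set (Mat 2 F × Mat 2 F) |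
      ∃ X Y : Mat 2 F, LowerTri X ∧ LowerTri Y ∧ Unimodular X Y ∧ M = cyc X Y}
      = Set.range fun p : Option F × Option F × F => cyc (normalFst p) (normalSnd p) := by
  ext M
  constructor
  · rintro ⟨X, Y, hX, hY, h, rfl⟩
    exact exists_cyc_eq_normal hX hY h
  · rintro ⟨⟨o, r, z⟩, rfl⟩
    refine ⟨_, _, (lowerTri_two_iff _).2 (by simp [normalFst]),
      (lowerTri_two_iff _).2 (by simp [normalSnd]), ?_, rfl⟩
    refine Fin.forall_fin_two.2 ⟨?_, ?_⟩
    · simpa [normalFst, normalSnd] using pointRep_ne_zero o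
    · simpa [normalFst, normalSnd] using pointRep_ne_zero r

end ProjectiveLine

theorem stmt_9 (q : ℕ) (hq : 2 ≤ q)
    (F : Type) [Field F] [Fintype F] (hF : Fintype.card F = q) :
    Set.ncard {M : Set (Mat 2 F × Mat 2 F) |
        ∃ X Y : Mat 2 F, LowerTri X ∧ LowerTri Y ∧ Unimodular X Y ∧ M = cyc X Y}
      = q * (q + 1) ^ 2 := by
  rw [setOf_unimodular_cyc_eq_range, ← Set.image_univ,
    Set.ncard_image_of_injective _ cyc_normal_injective, Set.ncard_univ,
    Nat.card_eq_fintype_card, Fintype.card_prod, Fintype.card_prod, Fintype.card_option, hF]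
  ring
end
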